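/- Suppose condition (⋆) holds. Then every simple graph g on {1,…,n} whose degree sequence satisfies η_i(g) = k_i for every firm i is pairwise stable for the profits Y: (1) for every edge ij of g, Y_i(g) ≥ Y_i(g − ij) and Y_j(g) ≥ Y_j(g − ij); (2) for every pair of distinct vertices ij not an edge of g, if Y_i(g + ij) > Y_i(g) then Y_j(g + ij) < Y_j(g). -/

import Mathlib

open Finset

noncomputable def degree' {n : ℕ} (g : SimpleGraph (Fin n)) (i : Fin n) : ℕ :=
  Nat.card {j | g.Adj i j}

/-- The graph `g` with the edge `ij` deleted. -/
def delE {n : ℕ} (g : SimpleGraph (Fin n)) (i j : Fin n) : SimpleGraph (Fin n) :=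
  g.deleteEdges {s(i, j)}

/-- The graph `g` with the edge `ij` added. -/
def addE {n : ℕ} (g : SimpleGraph (Fin n)) (i j : Fin n) : SimpleGraph (Fin n) :=
  g ⊔ SimpleGraph.fromEdgeSet {s(i, j)}

/-- Cournot equilibrium quantity of firm `i` under collaboration graph `g`. -/
noncomputable def qty {n : ℕ} (α γ₀ : ℝ) (f : ℝ → ℝ) (k : Fin n → ℕ)
    (g : SimpleGraph (Fin n)) (i : Fin n) : ℝ :=
  (α - γ₀ - n * f ((degree' g i : ℝ) - (k i : ℝ))
    + ∑ j ∈ univ.erase i, f ((degree' g j : ℝ) - (k j : ℝ))) / (n + 1)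

/-- Market price under collaboration graph `g`. -/
noncomputable def price {n : ℕ} (α γ₀ : ℝ) (f : ℝ → ℝ) (k : Fin n → ℕ)
    (g : SimpleGraph (Fin n)) : ℝ :=
  α - ∑ i, qty α γ₀ f k g i

/-- Marginal cost of firm `i` under collaboration graph `g`. -/
noncomputable def cost {n : ℕ} (γ₀ : ℝ) (f : ℝ → ℝ) (k : Fin n → ℕ)
    (g : SimpleGraph (Fin n)) (i : Fin n) : ℝ :=
  γ₀ + f ((degree' g i : ℝ) - (k i : ℝ))

/-- Profit of firm `i` under collaboration graph `g`. -/
noncomputable def profit {n : ℕ} (α γ₀ : ℝ) (f : ℝ → ℝ) (k : Fin n → ℕ)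
    (g : SimpleGraph (Fin n)) (i : Fin n) : ℝ :=
  qty α γ₀ f k g i * (price α γ₀ f k g - cost γ₀ f k g i)

theorem degree'_eq_ncard {n : ℕ} (g : SimpleGraph (Fin n)) (i : Fin n) :
    degree' g i = (g.neighborSet i).ncard := rfl

theorem delE_comm {n : ℕ} (g : SimpleGraph (Fin n)) (i j : Fin n) : delE g i j = delE g j i := by
  rw [delE, delE, Sym2.eq_swap]

theorem addE_comm {n : ℕ} (g : SimpleGraph (Fin n)) (i j : Fin n) : addE g i j = addE g j i := by
  rw [addE, addE, Sym2.eq_swap]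

theorem degree'_delE_add_one {n : ℕ} {g : SimpleGraph (Fin n)} {i j : Fin n} (h : g.Adj i j) :
    degree' (delE g i j) i + 1 = degree' g i := by
  have hset : (delE g i j).neighborSet i = g.neighborSet i \ {j} := by
    ext w
    have := h.ne
    simp only [delE, SimpleGraph.mem_neighborSet, SimpleGraph.deleteEdges_adj,
      Set.mem_singleton_iff, Sym2.eq_iff, Set.mem_sdiff]
    grind
  rw [degree'_eq_ncard, degree'_eq_ncard, hset]
  exact Set.ncard_sdiff_singleton_add_one h

theorem degree'_delE_of_ne {n : ℕ} (g : SimpleGraph (Fin n)) {i j v : Fin n}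
    (hi : v ≠ i) (hj : v ≠ j) : degree' (delE g i j) v = degree' g v := by
  have hset : (delE g i j).neighborSet v = g.neighborSet v := by
    ext w
    simp only [delE, SimpleGraph.mem_neighborSet, SimpleGraph.deleteEdges_adj,
      Set.mem_singleton_iff, Sym2.eq_iff]
    grind
  rw [degree'_eq_ncard, degree'_eq_ncard, hset]

theorem degree'_addE {n : ℕ} {g : SimpleGraph (Fin n)} {i j : Fin n} (hij : i ≠ j)
    (h : ¬ g.Adj i j) : degree' (addE g i j) i = degree' g i + 1 := by
  have hset : (addE g i j).neighborSet i = insert j (g.neighborSet i) := by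
    ext w
    simp only [addE, SimpleGraph.mem_neighborSet, SimpleGraph.sup_adj,
      SimpleGraph.fromEdgeSet_adj, Set.mem_singleton_iff, Sym2.eq_iff, Set.mem_insert_iff]
    grind
  rw [degree'_eq_ncard, degree'_eq_ncard, hset]
  exact Set.ncard_insert_of_notMem h

theorem degree'_addE_of_ne {n : ℕ} (g : SimpleGraph (Fin n)) {i j v : Fin n}
    (hi : v ≠ i) (hj : v ≠ j) : degree' (addE g i j) v = degree' g v := by
  have hset : (addE g i j).neighborSet v = g.neighborSet v := by
    ext w
    simp only [addE, SimpleGraph.mem_neighborSet, SimpleGraph.sup_adj,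
      SimpleGraph.fromEdgeSet_adj, Set.mem_singleton_iff, Sym2.eq_iff]
    grind
  rw [degree'_eq_ncard, degree'_eq_ncard, hset]

theorem qty_eq {n : ℕ} (α γ₀ : ℝ) (f : ℝ → ℝ) (k : Fin n → ℕ)
    (g : SimpleGraph (Fin n)) (i : Fin n) :
    qty α γ₀ f k g i = (α - γ₀ + ∑ j, f ((degree' g j : ℝ) - (k j : ℝ))) / (n + 1)
      - f ((degree' g i : ℝ) - (k i : ℝ)) := by
  have hn : (n : ℝ) + 1 ≠ 0 := by positivity
  rw [qty, ← Finset.add_sum_erase _ _ (Finset.mem_univ i)]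
  field_simp
  ring

/-- In Cournot equilibrium the markup of a firm equals its quantity, so profit is its square. -/
theorem profit_eq_qty_sq {n : ℕ} (α γ₀ : ℝ) (f : ℝ → ℝ) (k : Fin n → ℕ)
    (g : SimpleGraph (Fin n)) (i : Fin n) :
    profit α γ₀ f k g i = qty α γ₀ f k g i ^ 2 := by
  have hn : (n : ℝ) + 1 ≠ 0 := by positivity
  have hmarkup : price α γ₀ f k g - cost γ₀ f k g i = qty α γ₀ f k g i := by
    simp only [price, cost, qty_eq, Finset.sum_sub_distrib, Finset.sum_const, Finset.card_univ,
      Fintype.card_fin, nsmul_eq_mul]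
    field_simp
    ring
  rw [profit, hmarkup, sq]

theorem qty_of_degree'_eq {n : ℕ} (α γ₀ : ℝ) (f : ℝ → ℝ) {k : Fin n → ℕ}
    {g : SimpleGraph (Fin n)} (hdeg : ∀ i, degree' g i = k i) (i : Fin n) :
    qty α γ₀ f k g i = (α - γ₀ - f 0) / (n + 1) := by
  have hn : (n : ℝ) + 1 ≠ 0 := by positivity
  simp only [qty_eq, hdeg, sub_self, Finset.sum_const, Finset.card_univ, Fintype.card_fin,
    nsmul_eq_mul]
  field_simp
  ring

theorem qty_of_two_deviations {n : ℕ} (α γ₀ : ℝ) (f : ℝ → ℝ) {k : Fin n → ℕ}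
    {g : SimpleGraph (Fin n)} {i j : Fin n} (hij : i ≠ j) {d : ℝ}
    (hi : (degree' g i : ℝ) - k i = d) (hj : (degree' g j : ℝ) - k j = d)
    (hdeg : ∀ v, v ≠ i → v ≠ j → degree' g v = k v) :
    qty α γ₀ f k g i = (α - γ₀ - f 0 - (n - 1) * (f d - f 0)) / (n + 1) := by
  have hn : (n : ℝ) + 1 ≠ 0 := by positivity
  have hsum : ∑ v, (f ((degree' g v : ℝ) - k v) - f 0) = 2 * (f d - f 0) := by
    rw [Finset.sum_eq_add i j hij (fun v _ hv => by simp [hdeg v hv.1 hv.2])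
      (by simp) (by simp), hi, hj]
    ring
  simp only [Finset.sum_sub_distrib, Finset.sum_const, Finset.card_univ, Fintype.card_fin,
    nsmul_eq_mul, sub_eq_iff_eq_add] at hsum
  rw [qty_eq, hi, hsum]
  field_simp
  ring

theorem profit_le_of_two_deviations {n : ℕ} {α γ₀ : ℝ} {f : ℝ → ℝ} {k : Fin n → ℕ}
    {g g' : SimpleGraph (Fin n)} {i j : Fin n} (hij : i ≠ j) {d : ℝ} (hmin : f 0 ≤ f d)
    (hbound : ((n : ℝ) - 1) / 2 * (f d - f 0) ≤ α - γ₀ - f 0)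
    (hg : ∀ v, degree' g v = k v)
    (hi : (degree' g' i : ℝ) - k i = d) (hj : (degree' g' j : ℝ) - k j = d)
    (hg' : ∀ v, v ≠ i → v ≠ j → degree' g' v = k v) :
    profit α γ₀ f k g' i ≤ profit α γ₀ f k g i := by
  have hn : (1 : ℝ) ≤ n := by exact_mod_cast i.pos
  have hloss : 0 ≤ ((n : ℝ) - 1) * (f d - f 0) :=
    mul_nonneg (by linarith) (by linarith)
  rw [profit_eq_qty_sq, profit_eq_qty_sq, qty_of_two_deviations α γ₀ f hij hi hj hg',
    qty_of_degree'_eq α γ₀ f hg, div_pow, div_pow]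
  gcongr ?_ / _
  exact sq_le_sq' (by linarith) (by linarith)

/-- under condition (⋆), every graph with degree sequence `k` is
pairwise stable. -/
theorem stmt9 (n : ℕ) (hn : 2 ≤ n) (α γ₀ : ℝ) (f : ℝ → ℝ)
    (hconv : ConvexOn ℝ Set.univ f) (hf0 : ∀ x, 0 ≤ f x) (hfmin : ∀ x, f 0 ≤ f x)
    (k : Fin n → ℕ) (hk : ∀ i, k i ≤ n - 1)
    (hstar : 0 < α - γ₀ - n * max (f ((n : ℝ) - 1)) (f (1 - (n : ℝ)))
      - (((n : ℝ) - 1) / 2) * max (f 1 - f 0) (f (-1) - f 0))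
    (g : SimpleGraph (Fin n)) (hdeg : ∀ i, degree' g i = k i) :
    (∀ i j : Fin n, g.Adj i j →
      profit α γ₀ f k (delE g i j) i ≤ profit α γ₀ f k g i ∧
      profit α γ₀ f k (delE g i j) j ≤ profit α γ₀ f k g j) ∧
    (∀ i j : Fin n, i ≠ j → ¬ g.Adj i j →
      profit α γ₀ f k g i < profit α γ₀ f k (addE g i j) i →
      profit α γ₀ f k (addE g i j) j < profit α γ₀ f k g j) := by
  have hn1 : (2 : ℝ) ≤ n := by exact_mod_cast hn
  have hmax : f 0 ≤ n * max (f ((n : ℝ) - 1)) (f (1 - (n : ℝ))) := by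
    have h1 := (hfmin _).trans (le_max_left (f ((n : ℝ) - 1)) (f (1 - (n : ℝ))))
    nlinarith [hf0 0]
  have hbound : ∀ d, f d - f 0 ≤ max (f 1 - f 0) (f (-1) - f 0) →
      ((n : ℝ) - 1) / 2 * (f d - f 0) ≤ α - γ₀ - f 0 := fun d hd => by
    have := mul_le_mul_of_nonneg_left hd (show 0 ≤ ((n : ℝ) - 1) / 2 by linarith)
    linarith
  have hdel : ∀ i j, g.Adj i j → (degree' (delE g i j) i : ℝ) - k i = -1 := fun i j h => by
    rw [← hdeg i, ← degree'_delE_add_one h]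
    push_cast
    ring
  have hadd : ∀ i j, i ≠ j → ¬ g.Adj i j → (degree' (addE g i j) i : ℝ) - k i = 1 :=
    fun i j hij h => by
      rw [← hdeg i, degree'_addE hij h]
      push_cast
      ring
  have hdel_le : ∀ i j, g.Adj i j →
      profit α γ₀ f k (delE g i j) i ≤ profit α γ₀ f k g i := fun i j h =>
    profit_le_of_two_deviations h.ne (hfmin _) (hbound _ (le_max_right _ _)) hdeg (hdel i j h)
      (delE_comm g i j ▸ hdel j i h.symm)
      fun v hi hj => (degree'_delE_of_ne g hi hj).trans (hdeg v)
  refine ⟨fun i j h => ⟨hdel_le i j h, delE_comm g i j ▸ hdel_le j i h.symm⟩,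
    fun i j hij h hlt => absurd hlt (not_lt.mpr ?_)⟩
  exact profit_le_of_two_deviations hij (hfmin _) (hbound _ (le_max_left _ _)) hdeg
    (hadd i j hij h) (addE_comm g i j ▸ hadd j i hij.symm fun h' => h h'.symm)
    fun v hi hj => (degree'_addE_of_ne g hi hj).trans (hdeg v)
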